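/- Let p, p_i ∈ (1,∞), q ∈ (1,∞) with p < q and ∑_{i=1}^m 1/p_i = 1/p. Let ρ, φ, φ_i : ℝⁿ×(0,∞) → (0,∞). Assume φ, φ_i ∈ 𝒢^dec satisfy ∏_{i=1}^m φ_i^{1/p_i} = φ^{1/p}, the doubling condition, and lim_{r→0} φ(x,r) = ∞, lim_{r→∞} φ(x,r) = 0, lim_{r→0} φ_i(x,r) = ∞, lim_{r→∞} φ_i(x,r) = 0 for each x. Assume also there is C₀ > 0 with ρ(x,r)φ(x,r)^{1/p} ≤ C₀ φ(x,r)^{1/q} for all x ∈ ℝⁿ, r > 0. Then the generalized m-linear maximal operator 𝓜_ρ is bounded from L^{(p_1,φ_1)}(ℝⁿ)×⋯×L^{(p_m,φ_m)}(ℝⁿ) to L^{(q,φ)}(ℝⁿ): there is C > 0 with ‖𝓜_ρ(f⃗)‖_{L^{(q,φ)}} ≤ C ∏_{i=1}^m ‖f_i‖_{L^{(p_i,φ_i)}}. -/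

import Mathlib

open MeasureTheory Metric ENNReal Filter

/-- The generalized Morrey norm of a real function. -/
noncomputable def morreyNorm (n : ℕ) (p : ℝ)
    (φ : EuclideanSpace ℝ (Fin n) → ℝ → ℝ) (f : EuclideanSpace ℝ (Fin n) → ℝ) : ℝ≥0∞ :=
  ⨆ (x : EuclideanSpace ℝ (Fin n)) (r : ℝ) (_ : 0 < r),
    ((∫⁻ y in ball x r, ENNReal.ofReal (|f y| ^ p)) /
      (ENNReal.ofReal (φ x r) * volume (ball x r))) ^ (1 / p)

/-- The generalized Morrey norm of an `ℝ≥0∞`-valued function. -/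
noncomputable def morreyNormE (n : ℕ) (p : ℝ)
    (φ : EuclideanSpace ℝ (Fin n) → ℝ → ℝ) (g : EuclideanSpace ℝ (Fin n) → ℝ≥0∞) : ℝ≥0∞ :=
  ⨆ (x : EuclideanSpace ℝ (Fin n)) (r : ℝ) (_ : 0 < r),
    ((∫⁻ y in ball x r, g y ^ p) /
      (ENNReal.ofReal (φ x r) * volume (ball x r))) ^ (1 / p)

/-- The generalized `m`-linear maximal operator
`𝓜_ρ(f⃗)(x) = sup_{B ∋ x} ρ(B) ∏ᵢ ⨍_B |fᵢ|`. -/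
noncomputable def genMultiMaximal (n m : ℕ) (ρ : EuclideanSpace ℝ (Fin n) → ℝ → ℝ)
    (f : Fin m → EuclideanSpace ℝ (Fin n) → ℝ) (x : EuclideanSpace ℝ (Fin n)) : ℝ≥0∞ :=
  ⨆ (z : EuclideanSpace ℝ (Fin n)) (r : ℝ) (_ : 0 < r) (_ : x ∈ ball z r),
    ENNReal.ofReal (ρ z r) *
      ∏ i, (∫⁻ y in ball z r, ENNReal.ofReal |f i y|) / volume (ball z r)

/-- `φ ∈ 𝒢^dec`. -/
def Gdec (n : ℕ) (φ : EuclideanSpace ℝ (Fin n) → ℝ → ℝ) : Prop :=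
  ∃ C > (0 : ℝ), ∀ x (r s : ℝ), 0 < r → r < s →
    φ x s ≤ C * φ x r ∧ φ x r * r ^ (n : ℝ) ≤ C * (φ x s * s ^ (n : ℝ))

/-- Doubling condition. -/
def DoublingCond (n : ℕ) (φ : EuclideanSpace ℝ (Fin n) → ℝ → ℝ) : Prop :=
  ∃ C > (0 : ℝ), ∀ x (r s : ℝ), 0 < r → 0 < s → 1 / 2 ≤ r / s → r / s ≤ 2 →
    C⁻¹ ≤ φ x r / φ x s ∧ φ x r / φ x s ≤ C

/-- Auxiliary uncentred maximal function over balls with radius in `S`. -/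
noncomputable def mx (n : ℕ) (S : Set ℝ) (h : EuclideanSpace ℝ (Fin n) → ℝ≥0∞)
    (x : EuclideanSpace ℝ (Fin n)) : ℝ≥0∞ :=
  ⨆ (z : EuclideanSpace ℝ (Fin n)) (r : ℝ) (_ : 0 < r) (_ : r ∈ S) (_ : x ∈ ball z r),
    (∫⁻ y in ball z r, h y) / volume (ball z r)

lemma lt_mx_iff {n : ℕ} {S : Set ℝ} {h : EuclideanSpace ℝ (Fin n) → ℝ≥0∞}
    {x : EuclideanSpace ℝ (Fin n)} {a : ℝ≥0∞} :
    a < mx n S h x ↔ ∃ z r, 0 < r ∧ r ∈ S ∧ x ∈ ball z r ∧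
      a < (∫⁻ y in ball z r, h y) / volume (ball z r) := by
  simp only [mx, lt_iSup_iff, exists_prop]

lemma le_mx {n : ℕ} {S : Set ℝ} {h : EuclideanSpace ℝ (Fin n) → ℝ≥0∞}
    {x z : EuclideanSpace ℝ (Fin n)} {r : ℝ} (hr : 0 < r) (hS : r ∈ S) (hx : x ∈ ball z r) :
    (∫⁻ y in ball z r, h y) / volume (ball z r) ≤ mx n S h x := by
  refine le_of_forall_lt fun a ha => ?_
  exact lt_mx_iff.2 ⟨z, r, hr, hS, hx, ha⟩

lemma measurable_mx (n : ℕ) (S : Set ℝ) (h : EuclideanSpace ℝ (Fin n) → ℝ≥0∞) :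
    Measurable (mx n S h) := by
  refine measurable_of_Ioi fun a => IsOpen.measurableSet ?_
  rw [isOpen_iff_mem_nhds]
  intro x hx
  obtain ⟨z, r, hr, hS, hxz, ha⟩ := lt_mx_iff.1 hx
  filter_upwards [isOpen_ball.mem_nhds hxz] with y hy
  exact lt_mx_iff.2 ⟨z, r, hr, hS, hy, ha⟩

lemma vol_ball_mul (n : ℕ) (x z : EuclideanSpace ℝ (Fin n)) {r c : ℝ} (hr : 0 < r) (hc : 0 < c) :
    volume (ball x (c * r)) = ENNReal.ofReal (c ^ n) * volume (ball z r) := by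
  rw [Measure.addHaar_ball_mul_of_pos _ _ hc, Measure.addHaar_ball_center volume z]
  simp

lemma vol_closedBall_mul (n : ℕ) (x z : EuclideanSpace ℝ (Fin n)) {r c : ℝ} (hr : 0 < r)
    (hc : 0 < c) :
    volume (closedBall x (c * r)) = ENNReal.ofReal (c ^ n) * volume (ball z r) := by
  rw [Measure.addHaar_closedBall _ _ (by positivity), Measure.addHaar_ball_of_pos _ z hr,
    ← mul_assoc, ← ENNReal.ofReal_mul (by positivity), mul_pow]
  simp

lemma vol_ball_pos {n : ℕ} (x : EuclideanSpace ℝ (Fin n)) {r : ℝ} (hr : 0 < r) :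
    volume (ball x r) ≠ 0 := (measure_ball_pos _ _ hr).ne'

lemma vol_ball_top {n : ℕ} (x : EuclideanSpace ℝ (Fin n)) {r : ℝ} :
    volume (ball x r) ≠ ⊤ := measure_ball_lt_top.ne

lemma weak_cover (n : ℕ) (R : ℝ) (g : EuclideanSpace ℝ (Fin n) → ℝ≥0∞) (c : ℝ≥0∞)
    (A : Set (EuclideanSpace ℝ (Fin n)))
    (hA : ∀ x ∈ A, ∃ z r, 0 < r ∧ r ≤ R ∧ x ∈ ball z r ∧
      c * volume (ball z r) ≤ ∫⁻ y in ball z r, g y) :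
    c * volume A ≤ ENNReal.ofReal (5 ^ n) * ∫⁻ y, g y := by
  choose! z r hr hR hx hc using hA
  obtain ⟨u, hu, hd, hcov⟩ := Vitali.exists_disjoint_subfamily_covering_enlargement_closedBall
    A z r R hR 5 (by norm_num)
  have hd' : u.PairwiseDisjoint fun a => ball (z a) (r a) :=
    hd.mono fun a => ball_subset_closedBall
  have hcount : u.Countable := hd'.countable_of_isOpen (fun _ _ => isOpen_ball)
    (fun i hi => nonempty_ball.2 (hr i (hu hi)))
  have hsub : A ⊆ ⋃ a ∈ u, closedBall (z a) (5 * r a) := by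
    intro x hxA
    obtain ⟨b, hb, hbs⟩ := hcov x hxA
    exact Set.mem_biUnion hb (hbs (ball_subset_closedBall (hx x hxA)))
  have := hcount.to_subtype
  calc c * volume A ≤ c * ∑' a : u, volume (closedBall (z a) (5 * r a)) := by
        gcongr
        exact (measure_mono hsub).trans (measure_biUnion_le _ hcount _)
    _ = ∑' a : u, ENNReal.ofReal (5 ^ n) * (c * volume (ball (z a) (r a))) := by
        rw [← ENNReal.tsum_mul_left]
        congr 1; ext a
        rw [vol_closedBall_mul n (z a) (z a) (hr a (hu a.2)) (by norm_num)]
        ring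
    _ ≤ ∑' a : u, ENNReal.ofReal (5 ^ n) * ∫⁻ y in ball (z a) (r a), g y := by
        gcongr with a
        exact hc a (hu a.2)
    _ = ENNReal.ofReal (5 ^ n) * ∫⁻ y in ⋃ a ∈ u, ball (z a) (r a), g y := by
        rw [ENNReal.tsum_mul_left, lintegral_biUnion hcount (fun _ _ => measurableSet_ball) hd']
    _ ≤ _ := by
        gcongr
        exact Measure.restrict_le_self

lemma weak_type (n : ℕ) (R : ℝ) (u : EuclideanSpace ℝ (Fin n) → ℝ) (hu : Measurable u)
    (t : ℝ) (ht : 0 < t) :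
    volume {x | ENNReal.ofReal t < mx n (Set.Iic R) (fun y => ENNReal.ofReal (u y)) x} ≤
      ENNReal.ofReal (2 * 5 ^ n) * ENNReal.ofReal t⁻¹ *
        ∫⁻ y in {y | t < 2 * u y}, ENNReal.ofReal (u y) := by
  have hms : MeasurableSet {y | t < 2 * u y} := measurableSet_lt measurable_const (by fun_prop)
  have key := weak_cover n R ({y | t < 2 * u y}.indicator fun y => ENNReal.ofReal (u y))
    (ENNReal.ofReal (t / 2))
    {x | ENNReal.ofReal t < mx n (Set.Iic R) (fun y => ENNReal.ofReal (u y)) x} ?_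
  · rw [lintegral_indicator hms] at key
    have e : ENNReal.ofReal (2 * t⁻¹) * ENNReal.ofReal (t / 2) = 1 := by
      rw [← ENNReal.ofReal_mul (by positivity)]
      field_simp
      simp
    calc _ = ENNReal.ofReal (2 * t⁻¹) * (ENNReal.ofReal (t / 2) * volume _) := by
          rw [← mul_assoc, e, one_mul]
      _ ≤ ENNReal.ofReal (2 * t⁻¹) * (ENNReal.ofReal (5 ^ n) *
            ∫⁻ y in {y | t < 2 * u y}, ENNReal.ofReal (u y)) := mul_le_mul_right key _
      _ = _ := by
        rw [← mul_assoc, ← ENNReal.ofReal_mul (by positivity), ← ENNReal.ofReal_mul (by positivity)]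
        congr 2; ring
  · intro x hx
    obtain ⟨z, r, hr, hS, hxz, ha⟩ := lt_mx_iff.1 hx
    refine ⟨z, r, hr, hS, hxz, ?_⟩
    have h1 := (ENNReal.lt_div_iff_mul_lt (Or.inl (vol_ball_pos z hr)) (Or.inl (vol_ball_top z))).1 ha
    have h2 : ∫⁻ y in ball z r, ENNReal.ofReal (u y) ≤
        (∫⁻ y in ball z r, ({y | t < 2 * u y}.indicator (fun y => ENNReal.ofReal (u y))) y) +
          ENNReal.ofReal (t / 2) * volume (ball z r) := by
      rw [← setLIntegral_const, ← lintegral_add_right _ measurable_const]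
      refine lintegral_mono fun y => ?_
      by_cases hy : t < 2 * u y
      · rw [Set.indicator_of_mem (by exact hy)]; exact le_self_add
      · rw [Set.indicator_of_notMem (by exact hy), zero_add]
        exact ENNReal.ofReal_le_ofReal (by linarith)
    have h3 : ENNReal.ofReal t * volume (ball z r) =
      ENNReal.ofReal (t / 2) * volume (ball z r) + ENNReal.ofReal (t / 2) * volume (ball z r) := by
      rw [← add_mul, ← ENNReal.ofReal_add (by positivity) (by positivity), add_halves]
    rw [h3] at h1
    have h4 := h1.le.trans h2
    exact (ENNReal.add_le_add_iff_right
      (ENNReal.mul_ne_top ENNReal.ofReal_ne_top (vol_ball_top z))).1 h4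

lemma strong_type (n : ℕ) (R : ℝ) (u : EuclideanSpace ℝ (Fin n) → ℝ) (hu : Measurable u)
    (hu0 : ∀ y, 0 ≤ u y) (p : ℝ) (hp : 1 < p) :
    ∫⁻ x, mx n (Set.Iic R) (fun y => ENNReal.ofReal (u y)) x ^ p ≤
      ENNReal.ofReal (2 * 5 ^ n * (p / (p - 1)) * 2 ^ (p - 1)) *
        ∫⁻ y, ENNReal.ofReal (u y ^ p) := by
  have hp1 : 0 < p - 1 := by linarith
  set M := mx n (Set.Iic R) (fun y => ENNReal.ofReal (u y)) with hM
  have hMm : Measurable M := measurable_mx _ _ _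
  set B := ENNReal.ofReal (2 * 5 ^ n * (p / (p - 1)) * 2 ^ (p - 1)) *
        ∫⁻ y, ENNReal.ofReal (u y ^ p) with hB
  have hN : ∀ N : ℕ, ∫⁻ x, (min (M x) N) ^ p ≤ B := by
    intro N
    have hfin : ∀ x, min (M x) (N : ℝ≥0∞) ≠ ⊤ := fun x =>
      ((min_le_right _ _).trans_lt (ENNReal.natCast_lt_top N)).ne
    have e1 : ∀ x, (min (M x) N) ^ p = ENNReal.ofReal ((min (M x) (N : ℝ≥0∞)).toReal ^ p) := by
      intro x
      rw [← ENNReal.ofReal_rpow_of_nonneg ENNReal.toReal_nonneg (by linarith),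
        ENNReal.ofReal_toReal (hfin x)]
    set ν := (volume : Measure (EuclideanSpace ℝ (Fin n))).withDensity
      (fun y => ENNReal.ofReal (u y)) with hν
    have e2 := lintegral_rpow_eq_lintegral_meas_lt_mul ν (f := fun y => 2 * u y)
      (Eventually.of_forall fun y => by simpa using hu0 y) (by fun_prop) hp1
    have e3 : ∫⁻ y, ENNReal.ofReal ((2 * u y) ^ (p - 1)) ∂ν =
        ENNReal.ofReal (2 ^ (p - 1)) * ∫⁻ y, ENNReal.ofReal (u y ^ p) := by
      rw [hν, lintegral_withDensity_eq_lintegral_mul _ (by fun_prop) (by fun_prop),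
        ← lintegral_const_mul _ (by fun_prop)]
      congr 1; ext y
      simp only [Pi.mul_apply]
      rw [← ENNReal.ofReal_mul (hu0 y), ← ENNReal.ofReal_mul (by positivity)]
      congr 1
      rw [Real.mul_rpow (by norm_num) (hu0 y)]
      rcases (hu0 y).eq_or_lt with h0 | h0
      · rw [← h0, Real.zero_rpow (by linarith : p ≠ 0)]; simp
      · rw [Real.rpow_sub_one h0.ne']; field_simp
    simp_rw [e1]
    rw [lintegral_rpow_eq_lintegral_meas_lt_mul volume
      (Eventually.of_forall fun x => ENNReal.toReal_nonneg)
      (hMm.min measurable_const).ennreal_toReal.aemeasurable (by linarith : 0 < p)]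
    calc _ ≤ ENNReal.ofReal p * ∫⁻ t in Set.Ioi (0:ℝ), ENNReal.ofReal (2 * 5 ^ n) *
          (ν {y | t < 2 * u y} * ENNReal.ofReal (t ^ (p - 1 - 1))) := by
          gcongr ENNReal.ofReal p * ?_
          refine setLIntegral_mono' measurableSet_Ioi fun t ht => ?_
          have ht' : 0 < t := ht
          have w := weak_type n R u hu t ht'
          have hms : MeasurableSet {y | t < 2 * u y} :=
            measurableSet_lt measurable_const (by fun_prop)
          rw [hν, withDensity_apply _ hms]
          have hsub : {a | t < (min (M a) (N : ℝ≥0∞)).toReal} ⊆ {x | ENNReal.ofReal t < M x} := by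
            intro x hx
            exact ((ENNReal.ofReal_lt_iff_lt_toReal ht'.le (hfin x)).2 hx).trans_le
              (min_le_left _ _)
          calc _ ≤ _ := mul_le_mul_left ((measure_mono hsub).trans w) _
            _ = ENNReal.ofReal (2 * 5 ^ n) * ((∫⁻ y in {y | t < 2 * u y}, ENNReal.ofReal (u y)) *
                (ENNReal.ofReal t⁻¹ * ENNReal.ofReal (t ^ (p - 1)))) := by ring
            _ = _ := by
              rw [← ENNReal.ofReal_mul (by positivity), Real.rpow_sub_one ht'.ne' (p - 1)]
              rw [div_eq_inv_mul]
      _ = ENNReal.ofReal (2 * 5 ^ n * (p / (p - 1))) * (ENNReal.ofReal (p - 1) *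
            ∫⁻ t in Set.Ioi (0:ℝ), ν {y | t < 2 * u y} * ENNReal.ofReal (t ^ (p - 1 - 1))) := by
          rw [lintegral_const_mul' _ _ ENNReal.ofReal_ne_top, ← mul_assoc, ← mul_assoc,
            ← ENNReal.ofReal_mul (by positivity), ← ENNReal.ofReal_mul (by positivity)]
          congr 2; field_simp
      _ = B := by
          rw [← e2, e3, hB, ← mul_assoc, ← ENNReal.ofReal_mul (by positivity)]
      _ ≤ B := le_rfl
  have hsup : ∀ x, M x ^ p = ⨆ N : ℕ, (min (M x) N) ^ p := by
    intro x
    refine le_antisymm ?_ (iSup_le fun N => by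
      exact ENNReal.rpow_le_rpow (min_le_left _ _) (by linarith))
    by_cases h : M x = ⊤
    · simp only [h, le_top, inf_of_le_right]
      rw [ENNReal.top_rpow_of_pos (by linarith), top_le_iff, iSup_eq_top]
      intro b hb
      have : b ^ (1 / p) < ⊤ := ENNReal.rpow_lt_top_of_nonneg (by positivity) hb.ne
      obtain ⟨N, hN⟩ := ENNReal.exists_nat_gt this.ne
      refine ⟨N, ?_⟩
      rw [← ENNReal.rpow_lt_rpow_iff (by linarith : 0 < p), ← ENNReal.rpow_mul] at hN
      rwa [one_div_mul_cancel (by linarith), ENNReal.rpow_one] at hN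
    · obtain ⟨N, hN⟩ := ENNReal.exists_nat_gt h
      refine le_iSup_of_le N ?_
      rw [min_eq_left hN.le]
  simp_rw [hsup]
  rw [lintegral_iSup (fun N => (hMm.min measurable_const).pow_const p)]
  · exact iSup_le hN
  · intro a b hab x
    refine ENNReal.rpow_le_rpow ?_ (by linarith)
    gcongr

lemma morrey_int {n : ℕ} {p : ℝ} (hp : 1 < p) {φ : EuclideanSpace ℝ (Fin n) → ℝ → ℝ}
    (hφ : ∀ x r, 0 < r → 0 < φ x r) (f : EuclideanSpace ℝ (Fin n) → ℝ)
    (x : EuclideanSpace ℝ (Fin n)) {r : ℝ} (hr : 0 < r) :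
    ∫⁻ y in ball x r, ENNReal.ofReal (|f y| ^ p) ≤
      morreyNorm n p φ f ^ p * (ENNReal.ofReal (φ x r) * volume (ball x r)) := by
  have h : ((∫⁻ y in ball x r, ENNReal.ofReal (|f y| ^ p)) /
      (ENNReal.ofReal (φ x r) * volume (ball x r))) ^ (1 / p) ≤ morreyNorm n p φ f := by
    unfold morreyNorm
    exact le_iSup_of_le x (le_iSup_of_le r (le_iSup_of_le hr le_rfl))
  rw [one_div, ENNReal.rpow_inv_le_iff (by linarith)] at h
  rwa [ENNReal.div_le_iff] at h
  · exact mul_ne_zero (by simpa using hφ x r hr) (vol_ball_pos x hr)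
  · exact ENNReal.mul_ne_top ENNReal.ofReal_ne_top (vol_ball_top x)

lemma morrey_avg {n : ℕ} {p : ℝ} (hp : 1 < p) {φ : EuclideanSpace ℝ (Fin n) → ℝ → ℝ}
    (hφ : ∀ x r, 0 < r → 0 < φ x r) (f : EuclideanSpace ℝ (Fin n) → ℝ) (hf : Measurable f)
    (x : EuclideanSpace ℝ (Fin n)) {r : ℝ} (hr : 0 < r) :
    (∫⁻ y in ball x r, ENNReal.ofReal |f y|) / volume (ball x r) ≤
      ENNReal.ofReal (φ x r) ^ (1 / p) * morreyNorm n p φ f := by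
  have hp0 : 0 < p := by linarith
  have hq := Real.HolderConjugate.conjExponent hp
  set q := p.conjExponent with hqdef
  have H := ENNReal.lintegral_mul_le_Lp_mul_Lq (volume.restrict (ball x r)) hq
    (f := fun y => ENNReal.ofReal |f y|) (g := fun _ => 1) (by fun_prop) (by fun_prop)
  simp only [Pi.mul_apply, mul_one, ENNReal.one_rpow, lintegral_const, one_mul,
    Measure.restrict_apply_univ] at H
  have e : ∀ y, ENNReal.ofReal |f y| ^ p = ENNReal.ofReal (|f y| ^ p) := fun y =>
    ENNReal.ofReal_rpow_of_nonneg (abs_nonneg _) hp0.le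
  simp_rw [e] at H
  have I := morrey_int hp hφ f x hr
  rw [ENNReal.div_le_iff (vol_ball_pos x hr) (vol_ball_top x)]
  set V := volume (ball x r) with hV
  calc _ ≤ _ := H
    _ ≤ (morreyNorm n p φ f ^ p * (ENNReal.ofReal (φ x r) * V)) ^ (1 / p) * V ^ (1 / q) := by
        gcongr
    _ = ENNReal.ofReal (φ x r) ^ (1 / p) * morreyNorm n p φ f * (V ^ (1 / p) * V ^ (1 / q)) := by
        rw [ENNReal.mul_rpow_of_nonneg _ _ (by positivity),
          ENNReal.mul_rpow_of_nonneg _ _ (by positivity), ← ENNReal.rpow_mul,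
          mul_one_div_cancel hp0.ne', ENNReal.rpow_one]
        ring
    _ = _ := by
        rw [← ENNReal.rpow_add _ _ (vol_ball_pos x hr) (vol_ball_top x)]
        have := hq.inv_add_inv_eq_one
        rw [one_div, one_div, this, ENNReal.rpow_one]

lemma morrey_HL (n : ℕ) (p : ℝ) (hp : 1 < p) (φ : EuclideanSpace ℝ (Fin n) → ℝ → ℝ)
    (hφ : ∀ x r, 0 < r → 0 < φ x r) (hdec : Gdec n φ) :
    ∃ K : ℝ≥0∞, K ≠ ⊤ ∧ ∀ f : EuclideanSpace ℝ (Fin n) → ℝ, Measurable f → ∀ x r, 0 < r →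
      ∫⁻ y in ball x r, mx n Set.univ (fun y => ENNReal.ofReal |f y|) y ^ p ≤
        K * (morreyNorm n p φ f ^ p * (ENNReal.ofReal (φ x r) * volume (ball x r))) := by
  obtain ⟨C, hC, hd⟩ := hdec
  have hp0 : 0 < p := by linarith
  refine ⟨ENNReal.ofReal (2 * 5 ^ n * (p / (p - 1)) * 2 ^ (p - 1)) *
      (ENNReal.ofReal C * ENNReal.ofReal (2 ^ n)) +
      ENNReal.ofReal (4 ^ n) ^ p * ENNReal.ofReal C, ?_, ?_⟩
  · refine ENNReal.add_ne_top.2 ⟨?_, ?_⟩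
    · exact ENNReal.mul_ne_top ENNReal.ofReal_ne_top
        (ENNReal.mul_ne_top ENNReal.ofReal_ne_top ENNReal.ofReal_ne_top)
    · exact ENNReal.mul_ne_top (ENNReal.rpow_ne_top_of_nonneg hp0.le ENNReal.ofReal_ne_top)
        ENNReal.ofReal_ne_top
  intro f hf x r hr
  set N := morreyNorm n p φ f with hN
  set Φ := ENNReal.ofReal (φ x r) with hΦ
  have hmono : ∀ s, r < s → ENNReal.ofReal (φ x s) ≤ ENNReal.ofReal C * Φ := by
    intro s hs
    rw [hΦ, ← ENNReal.ofReal_mul hC.le]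
    exact ENNReal.ofReal_le_ofReal (hd x r s hr hs).1
  set u : EuclideanSpace ℝ (Fin n) → ℝ := (ball x (2 * r)).indicator fun y => |f y| with hu
  have hum : Measurable u := (by fun_prop : Measurable fun y => |f y|).indicator measurableSet_ball
  have hu0 : ∀ y, 0 ≤ u y := fun y => Set.indicator_nonneg (fun _ _ => abs_nonneg _) y
  set M1 := mx n (Set.Iic (r / 2)) (fun y => ENNReal.ofReal (u y)) with hM1
  set F := ENNReal.ofReal (4 ^ n) * ((ENNReal.ofReal C * Φ) ^ (1 / p) * N) with hF
  -- pointwise splitting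
  have hpt : ∀ y ∈ ball x r, mx n Set.univ (fun y => ENNReal.ofReal |f y|) y ^ p ≤
      M1 y ^ p + F ^ p := by
    intro y hy
    have hmax : mx n Set.univ (fun y => ENNReal.ofReal |f y|) y ≤ max (M1 y) F := by
      unfold mx
      refine iSup_le fun z => iSup_le fun s => iSup_le fun hs => iSup_le fun _ =>
        iSup_le fun hyz => ?_
      rw [mem_ball] at hy hyz
      by_cases hsr : s ≤ r / 2
      · refine le_max_of_le_left ?_
        refine le_trans (le_of_eq ?_) (le_mx (x := y) (z := z) hs hsr hyz)
        congr 1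
        refine setLIntegral_congr_fun measurableSet_ball fun w hw => ?_
        have : w ∈ ball x (2 * r) := by
          rw [mem_ball] at hw ⊢
          have h1 := dist_triangle w z x
          have h2 := dist_triangle z y x
          rw [dist_comm z y] at h2
          linarith
        simp only [hu, Set.indicator_of_mem this]
      · push Not at hsr
        refine le_max_of_le_right ?_
        have hsub : ball z s ⊆ ball x (4 * s) := by
          intro w hw
          rw [mem_ball] at hw ⊢
          have h1 := dist_triangle w z x
          have h2 := dist_triangle z y x
          rw [dist_comm z y] at h2
          linarith
        have h4 : 0 < 4 * s := by positivity
        have A := morrey_avg hp hφ f hf x h4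
        rw [ENNReal.div_le_iff (vol_ball_pos x h4) (vol_ball_top x),
          vol_ball_mul n x z hs (by norm_num)] at A
        rw [ENNReal.div_le_iff (vol_ball_pos z hs) (vol_ball_top z)]
        calc _ ≤ ∫⁻ y in ball x (4 * s), ENNReal.ofReal |f y| := lintegral_mono_set hsub
          _ ≤ _ := A
          _ ≤ (ENNReal.ofReal C * Φ) ^ (1 / p) * N *
              (ENNReal.ofReal (4 ^ n) * volume (ball z s)) := by
              gcongr
              exact hmono _ (by linarith)
          _ = _ := by rw [hF]; ring
    refine (ENNReal.rpow_le_rpow hmax hp0.le).trans ?_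
    rcases max_choice (M1 y) F with h | h <;> rw [h]
    · exact le_self_add
    · exact le_add_self
  have h2r : 0 < 2 * r := by positivity
  calc _ ≤ ∫⁻ y in ball x r, (M1 y ^ p + F ^ p) := setLIntegral_mono' measurableSet_ball hpt
    _ = (∫⁻ y in ball x r, M1 y ^ p) + F ^ p * volume (ball x r) := by
        rw [lintegral_add_right _ measurable_const, setLIntegral_const]
    _ ≤ ENNReal.ofReal (2 * 5 ^ n * (p / (p - 1)) * 2 ^ (p - 1)) *
        (N ^ p * ((ENNReal.ofReal C * Φ) * (ENNReal.ofReal (2 ^ n) * volume (ball x r)))) +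
        F ^ p * volume (ball x r) := by
        gcongr
        refine (lintegral_mono' Measure.restrict_le_self le_rfl).trans ?_
        refine (strong_type n (r / 2) u hum hu0 p hp).trans ?_
        gcongr
        have e : (fun y => ENNReal.ofReal (u y ^ p)) =
            (ball x (2 * r)).indicator fun y => ENNReal.ofReal (|f y| ^ p) := by
          ext y
          by_cases hy : y ∈ ball x (2 * r)
          · simp only [hu, Set.indicator_of_mem hy]
          · simp only [hu, Set.indicator_of_notMem hy, Real.zero_rpow hp0.ne', ENNReal.ofReal_zero]
        rw [e, lintegral_indicator measurableSet_ball]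
        refine (morrey_int hp hφ f x h2r).trans ?_
        rw [vol_ball_mul n x x hr (by norm_num)]
        gcongr
        exact hmono _ (by linarith)
    _ = _ := by
        rw [hF, ENNReal.mul_rpow_of_nonneg _ _ hp0.le, ENNReal.mul_rpow_of_nonneg _ _ hp0.le,
          ← ENNReal.rpow_mul, one_div_mul_cancel hp0.ne', ENNReal.rpow_one]
        ring

/-- boundedness of the generalized `m`-linear maximal operator `𝓜_ρ`
from `L^{(p₁,φ₁)} × ⋯ × L^{(p_m,φ_m)}` to `L^{(q,φ)}`. -/
theorem genMultiMaximal_bounded (n m : ℕ) (p q : ℝ) (pp : Fin m → ℝ)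
    (hp : 1 < p) (hq : 1 < q) (hpq : p < q) (hpp : ∀ i, 1 < pp i)
    (hsum : ∑ i, 1 / pp i = 1 / p)
    (ρ φ : EuclideanSpace ℝ (Fin n) → ℝ → ℝ)
    (φi : Fin m → EuclideanSpace ℝ (Fin n) → ℝ → ℝ)
    (hρpos : ∀ x r, 0 < r → 0 < ρ x r)
    (hφpos : ∀ x r, 0 < r → 0 < φ x r)
    (hφipos : ∀ i x r, 0 < r → 0 < φi i x r)
    (hprod : ∀ x (r : ℝ), 0 < r → ∏ i, φi i x r ^ (1 / pp i) = φ x r ^ (1 / p))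
    (hφdec : Gdec n φ) (hφidec : ∀ i, Gdec n (φi i))
    (hφdoub : DoublingCond n φ) (hφidoub : ∀ i, DoublingCond n (φi i))
    (hφ0 : ∀ x, Tendsto (fun r => φ x r) (nhdsWithin 0 (Set.Ioi 0)) atTop)
    (hφInf : ∀ x, Tendsto (fun r => φ x r) atTop (nhds 0))
    (hφi0 : ∀ i x, Tendsto (fun r => φi i x r) (nhdsWithin 0 (Set.Ioi 0)) atTop)
    (hφiInf : ∀ i x, Tendsto (fun r => φi i x r) atTop (nhds 0))
    (C₀ : ℝ) (hC₀ : 0 < C₀)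
    (hρφ : ∀ x (r : ℝ), 0 < r → ρ x r * φ x r ^ (1 / p) ≤ C₀ * φ x r ^ (1 / q)) :
    ∃ C : ℝ≥0∞, C ≠ ⊤ ∧
      ∀ f : Fin m → EuclideanSpace ℝ (Fin n) → ℝ,
        (∀ i, Measurable (f i)) → (∀ i, morreyNorm n (pp i) (φi i) (f i) ≠ ⊤) →
        morreyNormE n q φ (genMultiMaximal n m ρ f)
          ≤ C * ∏ i, morreyNorm n (pp i) (φi i) (f i) := by
  have hp0 : 0 < p := by linarith
  have hq0 : 0 < q := by linarith
  have hpp0 : ∀ i, 0 < pp i := fun i => by linarith [hpp i]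
  have hθ : 0 ≤ 1 - p / q := by
    rw [sub_nonneg, div_le_one hq0]; exact hpq.le
  choose K hK hKb using fun i => morrey_HL n (pp i) (hpp i) (φi i) (hφipos i) (hφidec i)
  -- constants
  refine ⟨(ENNReal.ofReal C₀ ^ q * ∏ i, K i ^ (p / pp i)) ^ (1 / q), ?_, ?_⟩
  · refine ENNReal.rpow_ne_top_of_nonneg (by positivity) (ENNReal.mul_ne_top
      (ENNReal.rpow_ne_top_of_nonneg hq0.le ENNReal.ofReal_ne_top) ?_)
    exact ENNReal.prod_ne_top fun i _ =>
      ENNReal.rpow_ne_top_of_nonneg (div_nonneg hp0.le (hpp0 i).le) (hK i)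
  intro f hf hfin
  set N : Fin m → ℝ≥0∞ := fun i => morreyNorm n (pp i) (φi i) (f i) with hN
  set P : ℝ≥0∞ := ∏ i, N i with hP
  have hPtop : P ≠ ⊤ := ENNReal.prod_ne_top fun i _ => hfin i
  set M : Fin m → EuclideanSpace ℝ (Fin n) → ℝ≥0∞ :=
    fun i => mx n Set.univ (fun y => ENNReal.ofReal |f i y|) with hM
  have hprodE : ∀ x (r : ℝ), 0 < r →
      ∏ i, ENNReal.ofReal (φi i x r) ^ (1 / pp i) = ENNReal.ofReal (φ x r) ^ (1 / p) := by
    intro x r hr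
    rw [ENNReal.ofReal_rpow_of_pos (hφpos x r hr), ← hprod x r hr,
      ENNReal.ofReal_prod_of_nonneg (fun i _ => by have := hφipos i x r hr; positivity)]
    exact Finset.prod_congr rfl fun i _ => ENNReal.ofReal_rpow_of_pos (hφipos i x r hr)
  -- Hedberg type pointwise estimate
  have hpt : ∀ y, genMultiMaximal n m ρ f y ≤
      ENNReal.ofReal C₀ * (∏ i, M i y) ^ (p / q) * P ^ (1 - p / q) := by
    intro y
    unfold genMultiMaximal
    refine iSup_le fun z => iSup_le fun r => iSup_le fun hr => iSup_le fun hyz => ?_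
    set A := ∏ i, (∫⁻ y in ball z r, ENNReal.ofReal |f i y|) / volume (ball z r) with hA
    have hA1 : A ≤ ∏ i, M i y :=
      Finset.prod_le_prod' fun i _ => le_mx hr (Set.mem_univ _) hyz
    have hA2 : A ≤ ENNReal.ofReal (φ z r) ^ (1 / p) * P := by
      rw [← hprodE z r hr, hP, ← Finset.prod_mul_distrib]
      exact Finset.prod_le_prod' fun i _ => morrey_avg (hpp i) (hφipos i) (f i) (hf i) z hr
    have hφp := hφpos z r hr
    have hρ : ENNReal.ofReal (ρ z r) * (ENNReal.ofReal (φ z r) ^ (1 / p)) ^ (1 - p / q) ≤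
        ENNReal.ofReal C₀ := by
      rw [← ENNReal.rpow_mul, ENNReal.ofReal_rpow_of_pos hφp,
        ← ENNReal.ofReal_mul (hρpos z r hr).le]
      refine ENNReal.ofReal_le_ofReal ?_
      have e : 1 / p * (1 - p / q) = 1 / p - 1 / q := by field_simp
      rw [e, Real.rpow_sub hφp, ← mul_div_assoc, div_le_iff₀ (by positivity)]
      exact hρφ z r hr
    calc ENNReal.ofReal (ρ z r) * A = ENNReal.ofReal (ρ z r) * (A ^ (p / q) * A ^ (1 - p / q)) := by
          rw [← ENNReal.rpow_add_of_nonneg _ _ (by positivity) hθ, add_sub_cancel, ENNReal.rpow_one]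
      _ ≤ ENNReal.ofReal (ρ z r) * ((∏ i, M i y) ^ (p / q) *
            (ENNReal.ofReal (φ z r) ^ (1 / p) * P) ^ (1 - p / q)) := by gcongr
      _ = (ENNReal.ofReal (ρ z r) * (ENNReal.ofReal (φ z r) ^ (1 / p)) ^ (1 - p / q)) *
            (∏ i, M i y) ^ (p / q) * P ^ (1 - p / q) := by
          rw [ENNReal.mul_rpow_of_nonneg _ _ hθ]; ring
      _ ≤ _ := by gcongr
  have hptq : ∀ y, genMultiMaximal n m ρ f y ^ q ≤
      (ENNReal.ofReal C₀ ^ q * P ^ (q - p)) * ∏ i, (M i y ^ pp i) ^ (p / pp i) := by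
    intro y
    refine (ENNReal.rpow_le_rpow (hpt y) hq0.le).trans (le_of_eq ?_)
    rw [ENNReal.mul_rpow_of_nonneg _ _ hq0.le, ENNReal.mul_rpow_of_nonneg _ _ hq0.le,
      ← ENNReal.rpow_mul, ← ENNReal.rpow_mul, div_mul_cancel₀ _ hq0.ne',
      show (1 - p / q) * q = q - p by field_simp]
    have : ∏ i, (M i y ^ pp i) ^ (p / pp i) = (∏ i, M i y) ^ p := by
      rw [← ENNReal.prod_rpow_of_nonneg hp0.le]
      refine Finset.prod_congr rfl fun i _ => ?_
      rw [← ENNReal.rpow_mul, mul_div_cancel₀ _ (hpp0 i).ne']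
    rw [this]; ring
  have hw : ∑ i, p / pp i = 1 := by
    have : ∑ i, p / pp i = p * ∑ i, 1 / pp i := by
      rw [Finset.mul_sum]; exact Finset.sum_congr rfl fun i _ => by ring
    rw [this, hsum, mul_one_div_cancel hp0.ne']
  unfold morreyNormE
  refine iSup_le fun x => iSup_le fun r => iSup_le fun hr => ?_
  set Φ := ENNReal.ofReal (φ x r) with hΦ
  set V := volume (ball x r) with hV
  have hΦ0 : Φ ≠ 0 := by simpa [hΦ] using hφpos x r hr
  have hΦV0 : Φ * V ≠ 0 := mul_ne_zero hΦ0 (vol_ball_pos x hr)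
  have hΦVt : Φ * V ≠ ⊤ := ENNReal.mul_ne_top ENNReal.ofReal_ne_top (vol_ball_top x)
  have hmain : ∫⁻ y in ball x r, genMultiMaximal n m ρ f y ^ q ≤
      (ENNReal.ofReal C₀ ^ q * ∏ i, K i ^ (p / pp i)) * P ^ q * (Φ * V) := by
    have hconst : ENNReal.ofReal C₀ ^ q * P ^ (q - p) ≠ ⊤ := ENNReal.mul_ne_top
      (ENNReal.rpow_ne_top_of_nonneg hq0.le ENNReal.ofReal_ne_top)
      (ENNReal.rpow_ne_top_of_nonneg (by linarith) hPtop)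
    calc _ ≤ ∫⁻ y in ball x r, (ENNReal.ofReal C₀ ^ q * P ^ (q - p)) *
          ∏ i, (M i y ^ pp i) ^ (p / pp i) := lintegral_mono hptq
      _ = (ENNReal.ofReal C₀ ^ q * P ^ (q - p)) *
          ∫⁻ y in ball x r, ∏ i, (M i y ^ pp i) ^ (p / pp i) := lintegral_const_mul' _ _ hconst
      _ ≤ (ENNReal.ofReal C₀ ^ q * P ^ (q - p)) *
          ∏ i, (∫⁻ y in ball x r, M i y ^ pp i) ^ (p / pp i) := by
          gcongr
          exact ENNReal.lintegral_prod_norm_pow_le Finset.univ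
            (fun i _ => ((measurable_mx n _ _).pow_const _).aemeasurable) hw
            (fun i _ => div_nonneg hp0.le (hpp0 i).le)
      _ ≤ (ENNReal.ofReal C₀ ^ q * P ^ (q - p)) *
          ∏ i, (K i * (N i ^ pp i * (ENNReal.ofReal (φi i x r) * V))) ^ (p / pp i) := by
          gcongr with i
          · exact div_nonneg hp0.le (hpp0 i).le
          · exact hKb i (f i) (hf i) x r hr
      _ = (ENNReal.ofReal C₀ ^ q * P ^ (q - p)) *
          ((∏ i, K i ^ (p / pp i)) * (P ^ p * (Φ * V))) := by
          congr 1
          have e1 : ∀ i, (K i * (N i ^ pp i * (ENNReal.ofReal (φi i x r) * V))) ^ (p / pp i) =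
              K i ^ (p / pp i) * (N i ^ p * ((ENNReal.ofReal (φi i x r) ^ (1 / pp i)) ^ p *
                V ^ (p / pp i))) := by
            intro i
            have h0 : 0 ≤ p / pp i := div_nonneg hp0.le (hpp0 i).le
            rw [ENNReal.mul_rpow_of_nonneg _ _ h0, ENNReal.mul_rpow_of_nonneg _ _ h0,
              ENNReal.mul_rpow_of_nonneg _ _ h0, ← ENNReal.rpow_mul, ← ENNReal.rpow_mul,
              mul_div_cancel₀ _ (hpp0 i).ne', one_div_mul_eq_div]
          simp_rw [e1, Finset.prod_mul_distrib]
          rw [ENNReal.prod_rpow_of_nonneg hp0.le, ENNReal.prod_rpow_of_nonneg hp0.le,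
            hprodE x r hr, ← ENNReal.rpow_mul, one_div_mul_cancel hp0.ne', ENNReal.rpow_one]
          have e2 : ∏ i, V ^ (p / pp i) = V := by
            have hVr : ∀ s : Finset (Fin m), ∏ i ∈ s, V ^ (p / pp i) = V ^ (∑ i ∈ s, p / pp i) := by
              intro s
              induction s using Finset.induction_on with
              | empty => simp
              | insert a s ha ih =>
                rw [Finset.prod_insert ha, Finset.sum_insert ha, ih,
                  ENNReal.rpow_add _ _ (vol_ball_pos x hr) (vol_ball_top x)]
            rw [hVr, hw, ENNReal.rpow_one]
          rw [e2]
      _ = _ := by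
          have e3 : P ^ q = P ^ (q - p) * P ^ p := by
            rw [← ENNReal.rpow_add_of_nonneg _ _ (by linarith) hp0.le, sub_add_cancel]
          rw [e3]; ring
  calc _ ≤ ((ENNReal.ofReal C₀ ^ q * ∏ i, K i ^ (p / pp i)) * P ^ q) ^ (1 / q) := by
        refine ENNReal.rpow_le_rpow ?_ (by positivity)
        rw [ENNReal.div_le_iff hΦV0 hΦVt]
        exact hmain
    _ = _ := by
        rw [ENNReal.mul_rpow_of_nonneg _ _ (by positivity : 0 ≤ 1 / q), ← ENNReal.rpow_mul P,
          mul_one_div_cancel hq0.ne', ENNReal.rpow_one]
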